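/- arXiv:2304.05005 — 3 statements merged into one kernel-verified Lean document; each statement's English description precedes it below -/
import Mathlib

section
/- Let T ≥ 1 and, for each player i ∈ N and round t ∈ {1,…,T}, let σ_i^t ∈ Δ(S_i). Define reward vectors u_i^t ∈ [0,1]^{Θ_i × A_i} by u_i^t(θ_i,a_i) = E_{θ_{-i}∼ρ|θ_i}[ ∑_{s_{-i}∈S_{-i}} (∏_{j≠i} σ_j^t(s_j)) · v_i(θ; a_i, s_{-i}(θ_{-i})) ]. Then the empirical distribution σ ∈ Δ(S) defined by σ(s) = (1/T)·∑_{t=1}^T ∏_{i∈N} σ_i^t(s_i) is an ε-approximate strategic-form correlated equilibrium with ε = (max_{i∈N} R_SS,i)/T, where R_SS,i is the strategy swap regret of the sequence (σ_i^t)_{t=1}^T with respect to the rewards (u_i^t)_{t=1}^T and prior ρ_i. -/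
open Finset
open scoped Classical

noncomputable section

/-- `f` is a probability distribution on the finite set `X`. -/
def IsDist {X : Type*} [Fintype X] (f : X → ℝ) : Prop :=
  (∀ x, f x ∈ Set.Icc (0 : ℝ) 1) ∧ ∑ x, f x = 1

variable {ι : Type*} [Fintype ι] [Nonempty ι]
  {Θ A : ι → Type*}
  [∀ i, Fintype (Θ i)] [∀ i, Nonempty (Θ i)]
  [∀ i, Fintype (A i)] [∀ i, Nonempty (A i)]

/-- The marginal `ρ_i(θ_i)` of the prior `ρ` for player `i`. -/
def marginal (ρ : ((i : ι) → Θ i) → ℝ) (i : ι) (θi : Θ i) : ℝ :=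
  ∑ θ : (j : ι) → Θ j, if θ i = θi then ρ θ else 0

/-- ε-approximate strategic-form correlated equilibrium (incentive constraints). -/
def IsSFCE (ρ : ((i : ι) → Θ i) → ℝ)
    (v : (i : ι) → ((j : ι) → Θ j) → ((j : ι) → A j) → ℝ) (ε : ℝ)
    (σ : ((i : ι) → Θ i → A i) → ℝ) : Prop :=
  ∀ (i : ι) (φ : (Θ i → A i) → Θ i → A i),
    ∑ θ, ρ θ * ∑ s : (j : ι) → Θ j → A j, σ s * v i θ (fun j => s j (θ j)) ≥
      ∑ θ, ρ θ * ∑ s : (j : ι) → Θ j → A j,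
        σ s * v i θ (Function.update (fun j => s j (θ j)) i (φ (s i) (θ i))) - ε

/-- The strategy swap regret of player `i` for decisions `σt i` and rewards `u i`
with respect to the prior marginals of `ρ`. -/
def stratSwapRegret (ρ : ((i : ι) → Θ i) → ℝ) (T : ℕ)
    (σt : (i : ι) → Fin T → (Θ i → A i) → ℝ)
    (u : (i : ι) → Fin T → Θ i → A i → ℝ) (i : ι) : ℝ :=
  ⨆ φ : (Θ i → A i) → Θ i → A i,
    ∑ t, ∑ θi, marginal ρ i θi *
      ∑ si : Θ i → A i, σt i t si * (u i t θi (φ si θi) - u i t θi (si θi))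

theorem isDist_of_nonneg {X : Type*} [Fintype X] {f : X → ℝ} (h0 : ∀ x, 0 ≤ f x)
    (h1 : ∑ x, f x = 1) : IsDist f :=
  ⟨fun x => ⟨h0 x, h1 ▸ Finset.single_le_sum (fun y _ => h0 y) (Finset.mem_univ x)⟩, h1⟩

theorem isDist_average_prod {κ : Type*} [Fintype κ] {S : κ → Type*} [∀ i, Fintype (S i)]
    {T : ℕ} (hT : 1 ≤ T) {p : (i : κ) → Fin T → S i → ℝ} (hp : ∀ i t, IsDist (p i t)) :
    IsDist (fun s : (i : κ) → S i => (∑ t : Fin T, ∏ i, p i t (s i)) / (T : ℝ)) := by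
  refine isDist_of_nonneg (fun s => ?_) ?_
  · exact div_nonneg (Finset.sum_nonneg fun t _ => Finset.prod_nonneg fun i _ =>
      ((hp i t).1 (s i)).1) (Nat.cast_nonneg T)
  · have hprod (t : Fin T) : ∑ s : (i : κ) → S i, ∏ i, p i t (s i) = 1 := by
      rw [← Fintype.prod_sum]
      exact Finset.prod_eq_one fun i _ => (hp i t).2
    have hT' : (T : ℝ) ≠ 0 := by positivity
    rw [← Finset.sum_div, Finset.sum_comm]
    simp [hprod, hT']

/-- Under a product distribution, coordinate `i` may be drawn independently of the profile
when the integrand does not otherwise depend on that coordinate. -/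
theorem sum_mul_sum_prod_eq {κ : Type*} [Fintype κ] {S : κ → Type*} [∀ i, Fintype (S i)]
    (p : (i : κ) → S i → ℝ) (i : κ) (hp : ∑ x, p i x = 1)
    (F : S i → ((j : κ) → S j) → ℝ)
    (hF : ∀ x s y, F x (Function.update s i y) = F x s) :
    ∑ x, p i x * ∑ s, (∏ j, p j (s j)) * F x s = ∑ s, (∏ j, p j (s j)) * F (s i) s := by
  have hsplit (s : (j : κ) → S j) :
      ∏ j, p j (s j) = p i (s i) * ∏ j ∈ Finset.univ.erase i, p j (s j) :=
    (Finset.mul_prod_erase _ _ (Finset.mem_univ i)).symm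
  have hrest (s : (j : κ) → S j) (x : S i) :
      ∏ j ∈ Finset.univ.erase i, p j (Function.update s i x j) =
        ∏ j ∈ Finset.univ.erase i, p j (s j) :=
    Finset.prod_congr rfl fun j hj => by
      rw [Function.update_of_ne (Finset.ne_of_mem_erase hj)]
  let swap : S i × ((j : κ) → S j) → S i × ((j : κ) → S j) :=
    fun q => (q.2 i, Function.update q.2 i q.1)
  have hswap : Function.Involutive swap := fun q => by simp [swap]
  calc
    _ = ∑ q : S i × ((j : κ) → S j), p i q.1 * ((∏ j, p j (q.2 j)) * F q.1 q.2) := by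
      simp only [Fintype.sum_prod_type, Finset.mul_sum]
    _ = ∑ q : S i × ((j : κ) → S j), p i q.1 * ((∏ j, p j (q.2 j)) * F (q.2 i) q.2) := by
      refine Fintype.sum_equiv hswap.toPerm _ _ fun q => ?_
      change _ = p i (q.2 i) * ((∏ j, p j (Function.update q.2 i q.1 j)) *
        F (Function.update q.2 i q.1 i) (Function.update q.2 i q.1))
      rw [hF, Function.update_self, hsplit, hsplit, hrest, Function.update_self]
      ring
    _ = _ := by
      rw [Fintype.sum_prod_type]
      simp only [← Finset.mul_sum]
      rw [← Finset.sum_mul, hp, one_mul]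

/-- The payoff of player `i` deviating by `ψ` under independent play, expressed through the
interim rewards. -/
theorem sum_marginal_mul_reward {κ : Type*} [Fintype κ] {Ty B : κ → Type*}
    [∀ i, Fintype (Ty i)] [∀ i, Fintype (B i)]
    (ρ : ((i : κ) → Ty i) → ℝ) (i : κ) (hρ : ∀ x, 0 < marginal ρ i x)
    (w : ((j : κ) → Ty j) → ((j : κ) → B j) → ℝ)
    (p : (j : κ) → (Ty j → B j) → ℝ) (hp : ∑ x, p i x = 1)
    (r : Ty i → B i → ℝ)
    (hr : ∀ x b, r x b = (∑ θ : (j : κ) → Ty j, if θ i = x then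
        ρ θ * ∑ s : (j : κ) → Ty j → B j,
          (∏ j, p j (s j)) * w θ (Function.update (fun j => s j (θ j)) i b)
      else 0) / marginal ρ i x)
    (ψ : (Ty i → B i) → Ty i → B i) :
    ∑ x, marginal ρ i x * ∑ si, p i si * r x (ψ si x) =
      ∑ θ, ρ θ * ∑ s : (j : κ) → Ty j → B j,
        (∏ j, p j (s j)) * w θ (Function.update (fun j => s j (θ j)) i (ψ (s i) (θ i))) := by
  have hmul (x : Ty i) (b : B i) : marginal ρ i x * r x b =
      ∑ θ : (j : κ) → Ty j, if θ i = x then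
        ρ θ * ∑ s : (j : κ) → Ty j → B j,
          (∏ j, p j (s j)) * w θ (Function.update (fun j => s j (θ j)) i b)
      else 0 := by
    rw [hr, mul_div_cancel₀ _ (hρ x).ne']
  calc
    _ = ∑ x, ∑ si, p i si * ∑ θ : (j : κ) → Ty j, if θ i = x then
        ρ θ * ∑ s : (j : κ) → Ty j → B j,
          (∏ j, p j (s j)) * w θ (Function.update (fun j => s j (θ j)) i (ψ si x))
        else 0 := by
      refine Finset.sum_congr rfl fun x _ => ?_
      rw [Finset.mul_sum]
      refine Finset.sum_congr rfl fun si _ => ?_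
      rw [mul_left_comm, hmul]
    _ = ∑ θ : (j : κ) → Ty j, ∑ si, ∑ x, if θ i = x then
        p i si * (ρ θ * ∑ s : (j : κ) → Ty j → B j,
          (∏ j, p j (s j)) * w θ (Function.update (fun j => s j (θ j)) i (ψ si x)))
        else 0 := by
      rw [Finset.sum_congr rfl fun x _ => Finset.sum_congr rfl fun si _ => Finset.mul_sum _ _ _]
      simp only [mul_ite, mul_zero]
      rw [Finset.sum_congr rfl fun x _ => Finset.sum_comm, Finset.sum_comm]
      exact Finset.sum_congr rfl fun θ _ => Finset.sum_comm
    _ = _ := by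
      refine Finset.sum_congr rfl fun θ _ => ?_
      simp only [Finset.sum_ite_eq, Finset.mem_univ, if_true]
      rw [← sum_mul_sum_prod_eq p i hp
        (fun si s => w θ (Function.update (fun j => s j (θ j)) i (ψ si (θ i)))), Finset.mul_sum]
      · exact Finset.sum_congr rfl fun si _ => mul_left_comm _ _ _
      · intro si s y
        congr 1
        funext j
        rcases eq_or_ne j i with rfl | hj
        · simp
        · simp [hj]

/-- The empirical distribution of no-strategy-swap-regret dynamics is an
`(max_i R_SS,i)/T`-approximate strategic-form correlated equilibrium. -/
theorem dynamics_SFCE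
    (ρ : ((i : ι) → Θ i) → ℝ) (hρ : IsDist ρ)
    (hρm : ∀ (i : ι) (θi : Θ i), 0 < marginal ρ i θi)
    (v : (i : ι) → ((j : ι) → Θ j) → ((j : ι) → A j) → ℝ)
    (hv : ∀ i θ a, v i θ a ∈ Set.Icc (0 : ℝ) 1)
    (T : ℕ) (hT : 1 ≤ T)
    (σt : (i : ι) → Fin T → (Θ i → A i) → ℝ)
    (hσt : ∀ i t, IsDist (σt i t))
    (u : (i : ι) → Fin T → Θ i → A i → ℝ)
    (hu : ∀ (i : ι) (t : Fin T) (θi : Θ i) (ai : A i),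
      u i t θi ai =
        (∑ θ : (j : ι) → Θ j, if θ i = θi then
            ρ θ * ∑ s : (j : ι) → Θ j → A j,
              (∏ j, σt j t (s j)) * v i θ (Function.update (fun j => s j (θ j)) i ai)
          else 0) / marginal ρ i θi) :
    IsDist (fun s : (i : ι) → Θ i → A i => (∑ t : Fin T, ∏ i, σt i t (s i)) / (T : ℝ)) ∧
    IsSFCE ρ v ((⨆ i : ι, stratSwapRegret ρ T σt u i) / (T : ℝ))
      (fun s => (∑ t : Fin T, ∏ i, σt i t (s i)) / (T : ℝ)) := by
  refine ⟨isDist_average_prod hT hσt, fun i φ => ?_⟩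
  have hT0 : (0 : ℝ) < T := by exact_mod_cast hT
  have hpay (ψ : (Θ i → A i) → Θ i → A i) :
      ∑ θ, ρ θ * ∑ s : (j : ι) → Θ j → A j, (∑ t : Fin T, ∏ j, σt j t (s j)) / (T : ℝ) *
          v i θ (Function.update (fun j => s j (θ j)) i (ψ (s i) (θ i))) =
        (∑ t, ∑ θi, marginal ρ i θi * ∑ si, σt i t si * u i t θi (ψ si θi)) / T := by
    rw [Finset.sum_congr rfl fun t _ => sum_marginal_mul_reward ρ i (hρm i) (v i)
      (fun j => σt j t) (hσt i t).2 (u i t) (hu i t) ψ, Finset.sum_comm, Finset.sum_div]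
    refine Finset.sum_congr rfl fun θ _ => ?_
    rw [← Finset.mul_sum, mul_div_assoc, Finset.sum_comm, Finset.sum_div]
    congr 1
    refine Finset.sum_congr rfl fun s _ => ?_
    rw [← Finset.sum_mul]
    ring
  have hfollow := hpay id
  simp only [id, Function.update_eq_self_iff.mpr rfl] at hfollow
  have hregret : (∑ t, ∑ θi, marginal ρ i θi * ∑ si, σt i t si * u i t θi (φ si θi)) -
      ∑ t, ∑ θi, marginal ρ i θi * ∑ si, σt i t si * u i t θi (si θi) ≤
        ⨆ i : ι, stratSwapRegret ρ T σt u i := by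
    refine le_ciSup_of_le (Set.finite_range _).bddAbove i ?_
    refine le_ciSup_of_le (Set.finite_range _).bddAbove φ (le_of_eq ?_)
    simp only [mul_sub, Finset.sum_sub_distrib]
  have hdiv := div_le_div_of_nonneg_right hregret hT0.le
  rw [sub_div] at hdiv
  rw [hpay φ, hfollow]
  linarith
end
end

section
/- Let T ≥ 1 and, for each player i ∈ N and round t ∈ {1,…,T}, let π_i^t ∈ Δ(A_i)^{Θ_i}. Define reward vectors u_i^t ∈ [0,1]^{Θ_i × A_i} by u_i^t(θ_i,a_i) = E_{θ_{-i}∼ρ|θ_i}[ ∑_{a_{-i}} (∏_{j≠i} π_j^t(θ_j;a_j)) · v_i(θ; a_i, a_{-i}) ]. Then the empirical type-wise distribution π ∈ Δ(A)^Θ defined by π(θ;a) = (1/T)·∑_{t=1}^T ∏_{i∈N} π_i^t(θ_i;a_i) is strategy-representable and is an ε-approximate communication equilibrium with ε = (max_{i∈N} R_US,i)/T, where R_US,i is the untruthful swap regret of the sequence (π_i^t)_{t=1}^T with respect to the rewards (u_i^t)_{t=1}^T and prior ρ_i. -/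
open Finset
open scoped Classical

noncomputable section

variable {ι : Type*} [Fintype ι] [Nonempty ι]
  {Θ A : ι → Type*}
  [∀ i, Fintype (Θ i)] [∀ i, Nonempty (Θ i)]
  [∀ i, Fintype (A i)] [∀ i, Nonempty (A i)]

/-- The map `η : Δ(S) → Δ(A)^Θ` : `η(σ)(θ;a) = ∑_{s : s(θ) = a} σ(s)`. -/
def eta (σ : ((i : ι) → Θ i → A i) → ℝ) :
    ((i : ι) → Θ i) → ((i : ι) → A i) → ℝ :=
  fun θ a => ∑ s : (i : ι) → Θ i → A i, if (fun i => s i (θ i)) = a then σ s else 0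

/-- `π` is strategy-representable if it is realized by a distribution over strategy profiles. -/
def StrategyRepresentable (π : ((i : ι) → Θ i) → ((i : ι) → A i) → ℝ) : Prop :=
  ∃ σ : ((i : ι) → Θ i → A i) → ℝ, IsDist σ ∧ eta σ = π

/-- ε-approximate communication equilibrium (incentive constraints). -/
def IsCommEq (ρ : ((i : ι) → Θ i) → ℝ)
    (v : (i : ι) → ((j : ι) → Θ j) → ((j : ι) → A j) → ℝ) (ε : ℝ)
    (π : ((i : ι) → Θ i) → ((i : ι) → A i) → ℝ) : Prop :=
  ∀ (i : ι) (ψ : Θ i → Θ i) (φ : Θ i → A i → A i),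
    ∑ θ, ρ θ * ∑ a : (j : ι) → A j, π θ a * v i θ a ≥
      ∑ θ, ρ θ * ∑ a : (j : ι) → A j,
        π (Function.update θ i (ψ (θ i))) a *
          v i θ (Function.update a i (φ (θ i) (a i))) - ε

/-- The untruthful swap regret of player `i` for decisions `πt i` and rewards `u i`
with respect to the prior marginals of `ρ`. -/
def untruthfulSwapRegret (ρ : ((i : ι) → Θ i) → ℝ) (T : ℕ)
    (πt : (i : ι) → Fin T → Θ i → A i → ℝ)
    (u : (i : ι) → Fin T → Θ i → A i → ℝ) (i : ι) : ℝ :=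
  ⨆ ψ : Θ i → Θ i, ⨆ φ : Θ i → A i → A i,
    ∑ t, ∑ θi, marginal ρ i θi *
      ((∑ ai, πt i t (ψ θi) ai * u i t θi (φ θi ai)) - ∑ ai, πt i t θi ai * u i t θi ai)

/-- Drawing a function with independent coordinates `p y`, the probability that it takes the
value `b` at `x` is `p x b`. -/
theorem sum_pi_prod_indicator {X Y : Type*} [Fintype X] [Fintype Y]
    (p : X → Y → ℝ) (hp : ∀ x, ∑ y, p x y = 1) (x : X) (b : Y) :
    (∑ f : X → Y, if f x = b then ∏ y, p y (f y) else 0) = p x b := by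
  have h : ∀ f : X → Y, (if f x = b then ∏ y, p y (f y) else 0) =
      ∏ y, if y = x → f y = b then p y (f y) else 0 := by
    intro f
    rw [Finset.prod_ite_zero]
    simp
  simp_rw [h]
  rw [← Fintype.prod_sum (fun y c => if y = x → c = b then p y c else 0),
    Finset.prod_eq_single x]
  · simp
  · intro y _ hy
    simp [hy, hp]
  · simp

theorem eta_prod {ι : Type*} [Fintype ι] {Θ A : ι → Type*}
    [∀ i, Fintype (Θ i)] [∀ i, Fintype (A i)]
    (p : (i : ι) → Θ i → A i → ℝ) (hp : ∀ i θi, ∑ ai, p i θi ai = 1)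
    (θ : (i : ι) → Θ i) (a : (i : ι) → A i) :
    eta (fun s => ∏ i, ∏ θi, p i θi (s i θi)) θ a = ∏ i, p i (θ i) (a i) := by
  have h : ∀ s : (i : ι) → Θ i → A i,
      (if (fun i => s i (θ i)) = a then ∏ i, ∏ θi, p i θi (s i θi) else 0) =
      ∏ i, if s i (θ i) = a i then ∏ θi, p i θi (s i θi) else 0 := by
    intro s
    rw [Finset.prod_ite_zero]
    simp [funext_iff]
  simp_rw [eta, h]
  rw [← Fintype.prod_sum
    (fun i (f : Θ i → A i) => if f (θ i) = a i then ∏ θi, p i θi (f θi) else 0)]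
  exact Finset.prod_congr rfl fun i _ => sum_pi_prod_indicator (p i) (hp i) (θ i) (a i)

/-- An average of product type-wise distributions is strategy-representable. -/
theorem strategyRepresentable_average {ι : Type*} [Fintype ι] {Θ A : ι → Type*}
    [∀ i, Fintype (Θ i)] [∀ i, Fintype (A i)] (T : ℕ) (hT : 1 ≤ T)
    (πt : (i : ι) → Fin T → Θ i → A i → ℝ) (hπt : ∀ i t θi, IsDist (πt i t θi)) :
    StrategyRepresentable
      (fun (θ : (i : ι) → Θ i) (a : (j : ι) → A j) =>
        (∑ t : Fin T, ∏ i, πt i t (θ i) (a i)) / (T : ℝ)) := by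
  have hT0 : (T : ℝ) ≠ 0 := by positivity
  refine ⟨fun s => (∑ t : Fin T, ∏ i, ∏ θi, πt i t θi (s i θi)) / (T : ℝ),
    isDist_of_nonneg (fun s => ?_) ?_, ?_⟩
  · exact div_nonneg (Finset.sum_nonneg fun t _ => Finset.prod_nonneg fun i _ =>
      Finset.prod_nonneg fun θi _ => ((hπt i t θi).1 _).1) (Nat.cast_nonneg T)
  · have h : ∀ t : Fin T,
        ∑ s : (i : ι) → Θ i → A i, ∏ i, ∏ θi, πt i t θi (s i θi) = 1 := by
      intro t
      rw [← Fintype.prod_sum (fun i (f : Θ i → A i) => ∏ θi, πt i t θi (f θi))]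
      refine Finset.prod_eq_one fun i _ => ?_
      rw [← Fintype.prod_sum (fun θi ai => πt i t θi ai)]
      exact Finset.prod_eq_one fun θi _ => (hπt i t θi).2
    rw [← Finset.sum_div, Finset.sum_comm]
    simp [h, hT0]
  · funext θ a
    simp_rw [← eta_prod (fun i => πt i _) (fun i θi => (hπt i _ θi).2) θ a, eta]
    rw [Finset.sum_comm, Finset.sum_div]
    refine Finset.sum_congr rfl fun s _ => ?_
    split_ifs <;> simp

/-- Resampling coordinate `i` from `q` instead of `p i` under a product distribution. -/
theorem sum_prod_update_eq {ι : Type*} [Fintype ι] {A : ι → Type*} [∀ i, Fintype (A i)]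
    (i : ι) (p p' : (j : ι) → A j → ℝ) (hp : ∑ c, p i c = 1) (hpp' : ∀ j, j ≠ i → p' j = p j)
    (f : A i → A i) (F : ((j : ι) → A j) → ℝ) :
    ∑ a, (∏ j, p' j (a j)) * F (Function.update a i (f (a i))) =
      ∑ c, p' i c * ∑ a, (∏ j, p j (a j)) * F (Function.update a i (f c)) := by
  have hswap : Function.Involutive
      (fun x : ((j : ι) → A j) × A i => (Function.update x.1 i x.2, x.1 i)) := by
    rintro ⟨a, c⟩
    simp
  calc ∑ a, (∏ j, p' j (a j)) * F (Function.update a i (f (a i)))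
      = ∑ x : ((j : ι) → A j) × A i,
          p i x.2 * ((∏ j, p' j (x.1 j)) * F (Function.update x.1 i (f (x.1 i)))) := by
        rw [Fintype.sum_prod_type]
        simp_rw [← Finset.sum_mul, hp, one_mul]
    _ = ∑ x : ((j : ι) → A j) × A i,
          p' i x.2 * ((∏ j, p j (x.1 j)) * F (Function.update x.1 i (f x.2))) := by
        refine Fintype.sum_equiv (Function.Involutive.toPerm _ hswap) _ _ ?_
        rintro ⟨a, c⟩
        simp only [Function.Involutive.coe_toPerm, Function.update_idem]
        rw [← Finset.mul_prod_erase _ _ (Finset.mem_univ i),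
          ← Finset.mul_prod_erase _ (fun j => p j (Function.update a i c j)) (Finset.mem_univ i)]
        have h : ∏ j ∈ Finset.univ.erase i, p j (Function.update a i c j) =
            ∏ j ∈ Finset.univ.erase i, p' j (a j) := by
          refine Finset.prod_congr rfl fun j hj => ?_
          have hj := Finset.ne_of_mem_erase hj
          rw [Function.update_of_ne hj, hpp' j hj]
        rw [h, Function.update_self]
        ring
    _ = _ := by
        rw [Fintype.sum_prod_type, Finset.sum_comm]
        simp_rw [Finset.mul_sum]

/-- The expected reward of a deviation, computed from the reward vector of player `i`, is the
expected utility of that deviation. -/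
theorem sum_marginal_mul_reward_s4 {ι : Type*} [Fintype ι] {Θ A : ι → Type*}
    [∀ i, Fintype (Θ i)] [∀ i, Fintype (A i)]
    (ρ : ((i : ι) → Θ i) → ℝ) (i : ι) (hρm : ∀ θi, 0 < marginal ρ i θi)
    (w : ((j : ι) → Θ j) → ((j : ι) → A j) → ℝ)
    (p : (j : ι) → Θ j → A j → ℝ) (hp : ∀ θi, ∑ c, p i θi c = 1)
    (u : Θ i → A i → ℝ)
    (hu : ∀ θi ai, u θi ai =
      (∑ θ : (j : ι) → Θ j, if θ i = θi then
        ρ θ * ∑ a : (j : ι) → A j, (∏ j, p j (θ j) (a j)) * w θ (Function.update a i ai)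
        else 0) / marginal ρ i θi)
    (ψ : Θ i → Θ i) (φ : Θ i → A i → A i) :
    ∑ θi, marginal ρ i θi * ∑ ai, p i (ψ θi) ai * u θi (φ θi ai) =
      ∑ θ, ρ θ * ∑ a : (j : ι) → A j,
        (∏ j, p j (Function.update θ i (ψ (θ i)) j) (a j)) *
          w θ (Function.update a i (φ (θ i) (a i))) := by
  have hmu : ∀ θi ai, marginal ρ i θi * u θi ai =
      ∑ θ : (j : ι) → Θ j, if θ i = θi then
        ρ θ * ∑ a : (j : ι) → A j, (∏ j, p j (θ j) (a j)) * w θ (Function.update a i ai)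
        else 0 := by
    intro θi ai
    rw [hu, mul_div_cancel₀ _ (hρm θi).ne']
  have hdev : ∀ θ : (j : ι) → Θ j, ∑ a : (j : ι) → A j,
        (∏ j, p j (Function.update θ i (ψ (θ i)) j) (a j)) *
          w θ (Function.update a i (φ (θ i) (a i))) =
      ∑ c, p i (ψ (θ i)) c * ∑ a : (j : ι) → A j,
        (∏ j, p j (θ j) (a j)) * w θ (Function.update a i (φ (θ i) c)) := by
    intro θ
    rw [sum_prod_update_eq i (fun j => p j (θ j))
      (fun j => p j (Function.update θ i (ψ (θ i)) j)) (hp _)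
      (fun j hj => by rw [Function.update_of_ne hj]) (φ (θ i)) (w θ)]
    simp
  simp_rw [hdev]
  calc ∑ θi, marginal ρ i θi * ∑ ai, p i (ψ θi) ai * u θi (φ θi ai)
      = ∑ θi, ∑ ai, p i (ψ θi) ai * (marginal ρ i θi * u θi (φ θi ai)) := by
        simp_rw [Finset.mul_sum, mul_left_comm]
    _ = ∑ θi, ∑ θ : (j : ι) → Θ j, if θ i = θi then
          ρ θ * ∑ c, p i (ψ θi) c * ∑ a : (j : ι) → A j,
            (∏ j, p j (θ j) (a j)) * w θ (Function.update a i (φ θi c)) else 0 := by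
        refine Finset.sum_congr rfl fun θi _ => ?_
        simp_rw [hmu, Finset.mul_sum]
        rw [Finset.sum_comm]
        refine Finset.sum_congr rfl fun θ _ => ?_
        split_ifs
        · refine Finset.sum_congr rfl fun c _ => ?_
          rw [Finset.mul_sum]
          exact Finset.sum_congr rfl fun a _ => mul_left_comm _ _ _
        · simp
    _ = _ := by
        rw [Finset.sum_comm]
        simp

/-- The empirical type-wise distribution of no-untruthful-swap-regret dynamics is
strategy-representable and is an `(max_i R_US,i)/T`-approximate communication equilibrium. -/
theorem dynamics_communication_equilibrium
    (ρ : ((i : ι) → Θ i) → ℝ) (hρ : IsDist ρ)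
    (hρm : ∀ (i : ι) (θi : Θ i), 0 < marginal ρ i θi)
    (v : (i : ι) → ((j : ι) → Θ j) → ((j : ι) → A j) → ℝ)
    (hv : ∀ i θ a, v i θ a ∈ Set.Icc (0 : ℝ) 1)
    (T : ℕ) (hT : 1 ≤ T)
    (πt : (i : ι) → Fin T → Θ i → A i → ℝ)
    (hπt : ∀ i t θi, IsDist (πt i t θi))
    (u : (i : ι) → Fin T → Θ i → A i → ℝ)
    (hu : ∀ (i : ι) (t : Fin T) (θi : Θ i) (ai : A i),
      u i t θi ai =
        (∑ θ : (j : ι) → Θ j, if θ i = θi then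
            ρ θ * ∑ a : (j : ι) → A j,
              (∏ j, πt j t (θ j) (a j)) * v i θ (Function.update a i ai)
          else 0) / marginal ρ i θi) :
    StrategyRepresentable
      (fun θ (a : (j : ι) → A j) => (∑ t : Fin T, ∏ i, πt i t (θ i) (a i)) / (T : ℝ)) ∧
    IsCommEq ρ v ((⨆ i : ι, untruthfulSwapRegret ρ T πt u i) / (T : ℝ))
      (fun θ a => (∑ t : Fin T, ∏ i, πt i t (θ i) (a i)) / (T : ℝ)) := by
  refine ⟨strategyRepresentable_average T hT πt hπt, fun i ψ φ => ?_⟩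
  have hT0 : (0 : ℝ) < T := by exact_mod_cast hT
  have hdev : ∀ (ψ : Θ i → Θ i) (φ : Θ i → A i → A i),
      ∑ θ, ρ θ * ∑ a : (j : ι) → A j,
        (∑ t : Fin T, ∏ j, πt j t (Function.update θ i (ψ (θ i)) j) (a j)) / (T : ℝ) *
          v i θ (Function.update a i (φ (θ i) (a i))) =
      (∑ t, ∑ θi, marginal ρ i θi * ∑ ai, πt i t (ψ θi) ai * u i t θi (φ θi ai)) / (T : ℝ) := by
    intro ψ φ
    simp_rw [fun t => sum_marginal_mul_reward_s4 ρ i (hρm i) (v i) (fun j => πt j t)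
      (fun θi => (hπt i t θi).2) (u i t) (hu i t) ψ φ]
    rw [Finset.sum_comm, Finset.sum_div]
    refine Finset.sum_congr rfl fun θ _ => ?_
    rw [← Finset.mul_sum, Finset.sum_comm, mul_div_assoc, Finset.sum_div]
    congr 1
    refine Finset.sum_congr rfl fun a _ => ?_
    rw [← Finset.sum_mul]
    ring
  have htruth := hdev id (fun _ => id)
  simp only [id, Function.update_eq_self] at htruth
  have hregret : ∑ t, ∑ θi, marginal ρ i θi *
      ((∑ ai, πt i t (ψ θi) ai * u i t θi (φ θi ai)) - ∑ ai, πt i t θi ai * u i t θi ai) ≤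
      ⨆ i : ι, untruthfulSwapRegret ρ T πt u i := by
    refine le_trans ?_ (le_ciSup (Set.finite_range _).bddAbove i)
    refine le_trans ?_ (le_ciSup (Set.finite_range _).bddAbove ψ)
    exact le_ciSup (f := fun φ : Θ i → A i → A i => ∑ t, ∑ θi, marginal ρ i θi *
      ((∑ ai, πt i t (ψ θi) ai * u i t θi (φ θi ai)) - ∑ ai, πt i t θi ai * u i t θi ai))
      (Set.finite_range _).bddAbove φ
  simp_rw [mul_sub, Finset.sum_sub_distrib] at hregret
  rw [hdev, htruth, ge_iff_le, ← sub_div]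
  gcongr
  linarith
end
end

section
/- For every ε ≥ 0 and every type-wise distribution π ∈ Δ(A)^Θ, the following are equivalent: (i) π is an ε-approximate communication equilibrium and π is strategy-representable; (ii) π is an ε-approximate communication equilibrium and π ∈ Π_ANF^ε; (iii) there exists σ ∈ Δ(S) with η(σ) = π such that for every i ∈ N, every ψ : Θ_i → Θ_i, and every φ : Θ_i × A_i → A_i: E_{θ∼ρ} E_{s∼σ}[v_i(θ; s(θ))] ≥ E_{θ∼ρ} E_{s∼σ}[v_i(θ; φ(θ_i, s_i(ψ(θ_i))), s_{-i}(θ_{-i}))] − ε. -/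
open Finset
open scoped Classical

noncomputable section

variable {ι : Type*} [Fintype ι] [Nonempty ι]
  {Θ A : ι → Type*}
  [∀ i, Fintype (Θ i)] [∀ i, Nonempty (Θ i)]
  [∀ i, Fintype (A i)] [∀ i, Nonempty (A i)]

/-- ε-approximate agent-normal-form correlated equilibrium (incentive constraints). -/
def IsANFCE (ρ : ((i : ι) → Θ i) → ℝ)
    (v : (i : ι) → ((j : ι) → Θ j) → ((j : ι) → A j) → ℝ) (ε : ℝ)
    (σ : ((i : ι) → Θ i → A i) → ℝ) : Prop :=
  ∀ (i : ι) (φ : Θ i → A i → A i),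
    ∑ θ, ρ θ * ∑ s : (j : ι) → Θ j → A j, σ s * v i θ (fun j => s j (θ j)) ≥
      ∑ θ, ρ θ * ∑ s : (j : ι) → Θ j → A j,
        σ s * v i θ (Function.update (fun j => s j (θ j)) i (φ (θ i) (s i (θ i)))) - ε

omit [Nonempty ι] [∀ i, Nonempty (Θ i)] [∀ i, Nonempty (A i)] in
/-- Expectations under `eta σ θ` are expectations under `σ` of the induced action profile. -/
theorem sum_eta_mul (σ : ((i : ι) → Θ i → A i) → ℝ) (θ : (i : ι) → Θ i)
    (f : ((i : ι) → A i) → ℝ) :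
    ∑ a, eta σ θ a * f a = ∑ s : (i : ι) → Θ i → A i, σ s * f (fun i => s i (θ i)) := by
  simp only [eta, Finset.sum_mul, ite_mul, zero_mul]
  rw [Finset.sum_comm]
  simp

omit [Fintype ι] [Nonempty ι] [∀ i, Fintype (Θ i)] [∀ i, Nonempty (Θ i)]
  [∀ i, Fintype (A i)] [∀ i, Nonempty (A i)] in
/-- Misreporting by player `i` does not change the other players' prescribed actions. -/
theorem update_update_profile (s : (j : ι) → Θ j → A j) (θ : (j : ι) → Θ j) (i : ι)
    (t : Θ i) (b : A i) :
    Function.update (fun j => s j (Function.update θ i t j)) i b =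
      Function.update (fun j => s j (θ j)) i b := by
  ext j
  by_cases h : j = i
  · subst h; simp
  · simp [h]

omit [Nonempty ι] [∀ i, Nonempty (Θ i)] [∀ i, Nonempty (A i)] in
/-- The communication-equilibrium constraints of `eta σ`, expressed through `σ`. -/
theorem isCommEq_eta_iff (ρ : ((i : ι) → Θ i) → ℝ)
    (v : (i : ι) → ((j : ι) → Θ j) → ((j : ι) → A j) → ℝ) (ε : ℝ)
    (σ : ((i : ι) → Θ i → A i) → ℝ) :
    IsCommEq ρ v ε (eta σ) ↔
      ∀ (i : ι) (ψ : Θ i → Θ i) (φ : Θ i → A i → A i),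
        ∑ θ, ρ θ * ∑ s : (j : ι) → Θ j → A j, σ s * v i θ (fun j => s j (θ j)) ≥
          ∑ θ, ρ θ * ∑ s : (j : ι) → Θ j → A j,
            σ s * v i θ (Function.update (fun j => s j (θ j)) i
              (φ (θ i) (s i (ψ (θ i))))) - ε := by
  unfold IsCommEq
  refine forall_congr' fun i => forall_congr' fun ψ => forall_congr' fun φ => ?_
  have h (θ : (j : ι) → Θ j) := sum_eta_mul σ (Function.update θ i (ψ (θ i)))
    (fun a => v i θ (Function.update a i (φ (θ i) (a i))))
  simp only [update_update_profile, Function.update_self] at h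
  simp only [h, sum_eta_mul]

omit [Nonempty ι] [∀ i, Nonempty (Θ i)] [∀ i, Nonempty (A i)] in
theorem IsCommEq.isANFCE_of_eta {ρ : ((i : ι) → Θ i) → ℝ}
    {v : (i : ι) → ((j : ι) → Θ j) → ((j : ι) → A j) → ℝ} {ε : ℝ}
    {σ : ((i : ι) → Θ i → A i) → ℝ} (h : IsCommEq ρ v ε (eta σ)) :
    IsANFCE ρ v ε σ :=
  fun i φ => (isCommEq_eta_iff ρ v ε σ).1 h i id φ

/-- Characterizations of communication equilibria with strategy representability. -/
theorem commEq_strategyRepresentable_characterization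
    (ρ : ((i : ι) → Θ i) → ℝ) (hρ : IsDist ρ)
    (v : (i : ι) → ((j : ι) → Θ j) → ((j : ι) → A j) → ℝ)
    (hv : ∀ i θ a, v i θ a ∈ Set.Icc (0 : ℝ) 1)
    (ε : ℝ) (hε : 0 ≤ ε)
    (π : ((i : ι) → Θ i) → ((i : ι) → A i) → ℝ)
    (hπ : ∀ θ, IsDist (π θ)) :
    ((IsCommEq ρ v ε π ∧ StrategyRepresentable π) ↔
      (IsCommEq ρ v ε π ∧
        ∃ σ : ((i : ι) → Θ i → A i) → ℝ, IsDist σ ∧ IsANFCE ρ v ε σ ∧ eta σ = π)) ∧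
    ((IsCommEq ρ v ε π ∧
        ∃ σ : ((i : ι) → Θ i → A i) → ℝ, IsDist σ ∧ IsANFCE ρ v ε σ ∧ eta σ = π) ↔
      (∃ σ : ((i : ι) → Θ i → A i) → ℝ, IsDist σ ∧ eta σ = π ∧
        ∀ (i : ι) (ψ : Θ i → Θ i) (φ : Θ i → A i → A i),
          ∑ θ, ρ θ * ∑ s : (j : ι) → Θ j → A j, σ s * v i θ (fun j => s j (θ j)) ≥
            ∑ θ, ρ θ * ∑ s : (j : ι) → Θ j → A j,
              σ s * v i θ (Function.update (fun j => s j (θ j)) i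
                (φ (θ i) (s i (ψ (θ i))))) - ε)) := by
  refine ⟨⟨?_, ?_⟩, ⟨?_, ?_⟩⟩
  · rintro ⟨h, σ, hσ, rfl⟩
    exact ⟨h, σ, hσ, h.isANFCE_of_eta, rfl⟩
  · rintro ⟨h, σ, hσ, -, hη⟩
    exact ⟨h, σ, hσ, hη⟩
  · rintro ⟨h, σ, hσ, -, rfl⟩
    exact ⟨σ, hσ, rfl, (isCommEq_eta_iff ρ v ε σ).1 h⟩
  · rintro ⟨σ, hσ, rfl, h⟩
    have hc := (isCommEq_eta_iff ρ v ε σ).2 h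
    exact ⟨hc, σ, hσ, hc.isANFCE_of_eta, rfl⟩
end
end
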